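/- Let L_1, …, L_n be connected simple closure spaces, L_i on Σ_i, let L ∈ S(L_1,…,L_n) be a weak tensor product, and let u : L → L be a large map preserving arbitrary joins and sending atoms to atoms. Then there exist a bijection f of {1,…,n} and, for each i, a map v_i : L_i → L_{f(i)} preserving arbitrary joins and sending atoms to atoms, such that u(p)_{f(i)} = v_i(p_i) for every p ∈ ∏_j Σ_j and every i. -/

import Mathlib

open Set

namespace QLTensor

universe u v w

/-- A simple closure space on `X`: a set of subsets of `X`, closed under arbitrary
set-intersections, containing `∅`, `univ` and all singletons. -/
def IsSCS {X : Type*} (L : Set (Set X)) : Prop :=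
  (∀ ω ⊆ L, ⋂₀ ω ∈ L) ∧ ∅ ∈ L ∧ Set.univ ∈ L ∧ ∀ p : X, ({p} : Set X) ∈ L

/-- The join in a simple closure space: `⋁ A = ⋂ {b ∈ L | A ⊆ b}`. -/
def cl {X : Type*} (L : Set (Set X)) (A : Set X) : Set X :=
  ⋂₀ {b | b ∈ L ∧ A ⊆ b}

/-- `b` covers `a` in the lattice `L` (both belonging to `L`). -/
def CoversIn {X : Type*} (L : Set (Set X)) (a b : Set X) : Prop :=
  a ∈ L ∧ b ∈ L ∧ a ⊂ b ∧ ∀ c ∈ L, a ⊂ c → c ⊂ b → False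

/-- `x` is a coatom of `L` (covered by the top element `univ`). -/
def IsCoatomIn {X : Type*} (L : Set (Set X)) (x : Set X) : Prop :=
  x ∈ L ∧ x ≠ Set.univ ∧ ∀ c ∈ L, x ⊂ c → c = Set.univ

/-- `L` is coatomistic: every element is an intersection of coatoms. -/
def Coatomistic {X : Type*} (L : Set (Set X)) : Prop :=
  ∀ a ∈ L, a = ⋂₀ {x | IsCoatomIn L x ∧ a ⊆ x}

/-- The covering property: if `p ∧ a = 0` then `p ∨ a` covers `a`. -/
def CovProp {X : Type*} (L : Set (Set X)) : Prop :=
  ∀ p : X, ∀ a ∈ L, p ∉ a → CoversIn L a (cl L (insert p a))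

/-- The covering property of the dual lattice. -/
def DualCovProp {X : Type*} (L : Set (Set X)) : Prop :=
  ∀ x : Set X, IsCoatomIn L x → ∀ a ∈ L, cl L (a ∪ x) = Set.univ →
    CoversIn L (a ∩ x) a

/-- A DAC-lattice: `L` and its dual are atomistic with the covering property
(a simple closure space is automatically atomistic). -/
def IsDAC {X : Type*} (L : Set (Set X)) : Prop :=
  CovProp L ∧ Coatomistic L ∧ DualCovProp L

/-- `(a, b)` is a modular pair: `(c ∨ a) ∧ b = c ∨ (a ∧ b)` for all `c ≤ b`. -/
def ModularPairIn {X : Type*} (L : Set (Set X)) (a b : Set X) : Prop :=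
  ∀ c ∈ L, c ⊆ b → cl L (c ∪ a) ∩ b = cl L (c ∪ a ∩ b)

/-- `z` is a central element of the simple closure space `L`. -/
def IsCentralIn {X : Type*} (L : Set (Set X)) (z : Set X) : Prop :=
  zᶜ ∈ L ∧ ModularPairIn L z zᶜ ∧ ModularPairIn L zᶜ z

/-- `L` is irreducible: its only central elements are `∅` and `univ`. -/
def IrreducibleSCS {X : Type*} (L : Set (Set X)) : Prop :=
  ∀ z ∈ L, IsCentralIn L z → z = ∅ ∨ z = Set.univ

/-- `N` is an orthocomplementation of the simple closure space `L`. -/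
def IsOrtho {X : Type*} (L : Set (Set X)) (N : Set X → Set X) : Prop :=
  (∀ a ∈ L, N a ∈ L) ∧ (∀ a ∈ L, N (N a) = a) ∧
  (∀ a ∈ L, ∀ b ∈ L, a ⊆ b → N b ⊆ N a) ∧
  ∀ a ∈ L, cl L (a ∪ N a) = Set.univ

/-- `L` with orthocomplementation `N` is orthomodular. -/
def OrthomodularIn {X : Type*} (L : Set (Set X)) (N : Set X → Set X) : Prop :=
  ∀ a ∈ L, ∀ b ∈ L, a ⊆ b → b = cl L (a ∪ b ∩ N a)

/-- `L` contains `MO₃`. -/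
def ContainsMO3 {X : Type*} (L : Set (Set X)) : Prop :=
  ∃ p q r : X, p ≠ q ∧ p ≠ r ∧ q ≠ r ∧
    CoversIn L {p} (cl L {p, q}) ∧ CoversIn L {q} (cl L {p, q}) ∧
    CoversIn L {r} (cl L {p, q})

/-- `L` contains `MO₄`. -/
def ContainsMO4 {X : Type*} (L : Set (Set X)) : Prop :=
  ∃ p₁ p₂ p₃ p₄ : X,
    p₁ ≠ p₂ ∧ p₁ ≠ p₃ ∧ p₁ ≠ p₄ ∧ p₂ ≠ p₃ ∧ p₂ ≠ p₄ ∧ p₃ ≠ p₄ ∧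
    CoversIn L {p₁} (cl L {p₁, p₄}) ∧ CoversIn L {p₂} (cl L {p₁, p₄}) ∧
    CoversIn L {p₃} (cl L {p₁, p₄}) ∧ CoversIn L {p₄} (cl L {p₁, p₄})

/-- `L` is connected. -/
def ConnectedSCS {X : Type*} (L : Set (Set X)) : Prop :=
  (∃ p q : X, p ≠ q) ∧
  ∀ p q : X, p ≠ q → ∃ r : X, r ≠ p ∧ r ≠ q ∧ r ∈ cl L {p, q} ∧
    p ∈ cl L {q, r} ∧ q ∈ cl L {p, r}

/-- `L` is weakly connected: `L ≠ 2` and the point set admits a connected covering. -/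
def WeaklyConnected {X : Type*} (L : Set (Set X)) : Prop :=
  (∃ p q : X, p ≠ q) ∧
  ∃ 𝒜 : Set (Set X),
    ⋃₀ 𝒜 = Set.univ ∧
    (∀ A ∈ 𝒜, ∃ p ∈ A, ∃ q ∈ A, p ≠ q) ∧
    (∀ A ∈ 𝒜, ∀ p ∈ A, ∀ q ∈ A, p ≠ q → ∃ r, r ≠ p ∧ r ≠ q ∧ r ∈ cl L {p, q}) ∧
    ∀ p q : X, ∃ (m : ℕ) (c : Fin (m + 1) → Set X),
      (∀ i, c i ∈ 𝒜) ∧ p ∈ c 0 ∧ q ∈ c (Fin.last m) ∧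
      ∀ i : Fin m, ∃ x ∈ c i.castSucc ∩ c i.succ, ∃ y ∈ c i.castSucc ∩ c i.succ, x ≠ y

/-- The central cover `e(p)` of an atom `p`. -/
def centralCover {X : Type*} (L : Set (Set X)) (p : X) : Set X :=
  ⋂₀ {z | z ∈ L ∧ IsCentralIn L z ∧ p ∈ z}

/-- The interval `[0, e]` of `L`, viewed as a simple closure space on `e`. -/
def restrictSCS {X : Type*} (L : Set (Set X)) (e : Set X) : Set (Set ↥e) :=
  {B | Subtype.val '' B ∈ L}

/-- The automorphism group of `M` acts transitively on points. -/
def TransitiveSCS {X : Type*} (M : Set (Set X)) : Prop :=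
  ∀ p q : X, ∃ u : X ≃ X, (∀ a : Set X, a ∈ M ↔ u '' a ∈ M) ∧ u p = q

section Pi

variable {Ω : Type*} {σ : Ω → Type*}

/-- `⋃_α π_α⁻¹ (a α)`. -/
def unionCyl (a : ∀ α, Set (σ α)) : Set (∀ α, σ α) :=
  {p | ∃ α, p α ∈ a α}

/-- `∏_α a_α`. -/
def prodSet (a : ∀ α, Set (σ α)) : Set (∀ α, σ α) :=
  {p | ∀ α, p α ∈ a α}

/-- `p[A, β]`. -/
def cylSet (p : ∀ α, σ α) (β : Ω) (A : Set (σ β)) : Set (∀ α, σ α) :=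
  {q | q β ∈ A ∧ ∀ α, α ≠ β → q α = p α}

/-- `R_β[p]`. -/
def secSet (R : Set (∀ α, σ α)) (β : Ω) (p : ∀ α, σ α) : Set (σ β) :=
  {x | ∃ q ∈ R, q β = x ∧ ∀ α, α ≠ β → q α = p α}

/-- The separated product `∧○_α L_α`. -/
def wedgeO (L : ∀ α, Set (Set (σ α))) : Set (Set (∀ α, σ α)) :=
  {S | ∃ ω : Set (Set (∀ α, σ α)),
    (∀ y ∈ ω, ∃ a : ∀ α, Set (σ α), (∀ α, a α ∈ L α) ∧ y = unionCyl a) ∧ S = ⋂₀ ω}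

/-- The product `∨○_α L_α`. -/
def veeO (L : ∀ α, Set (Set (σ α))) : Set (Set (∀ α, σ α)) :=
  {R | ∀ (β : Ω) (p : ∀ α, σ α), secSet R β p ∈ L β}

/-- Axiom P2. -/
def AxiomP2 (L : ∀ α, Set (Set (σ α))) (M : Set (Set (∀ α, σ α))) : Prop :=
  ∀ a : ∀ α, Set (σ α), (∀ α, a α ∈ L α) → unionCyl a ∈ M

/-- Axiom P3. -/
def AxiomP3 (L : ∀ α, Set (Set (σ α))) (M : Set (Set (∀ α, σ α))) : Prop :=
  ∀ (p : ∀ α, σ α) (β : Ω) (A : Set (σ β)), cylSet p β A ∈ M → A ∈ L β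

/-- `M` is a weak tensor product of the family `L`, i.e. `M ∈ S(L_α, α ∈ Ω)`. -/
def IsWTP (L : ∀ α, Set (Set (σ α))) (M : Set (Set (∀ α, σ α))) : Prop :=
  IsSCS M ∧ AxiomP2 L M ∧ AxiomP3 L M

/-- `p # q` iff `p_β ⊥_β q_β` for some `β`. -/
def hashRel (N : ∀ α, Set (σ α) → Set (σ α)) (p q : ∀ α, σ α) : Prop :=
  ∃ β, p β ∈ N β {q β}

/-- `R^#`. -/
def sharp (N : ∀ α, Set (σ α) → Set (σ α)) (R : Set (∀ α, σ α)) :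
    Set (∀ α, σ α) :=
  {q | ∀ p ∈ R, hashRel N q p}

/-- A join-preserving map `u` is large. -/
def LargeMap (u : Set (∀ α, σ α) → Set (∀ α, σ α)) : Prop :=
  ∀ (β : Ω) (p : ∀ α, σ α),
    (¬ ∃ x, u (cylSet p β Set.univ) = {x}) ∧ ¬ u Set.univ ⊆ {q | q β = p β}

end Pi

section Binary

variable {X Y : Type*}

/-- The binary product `L₁ ∨○ L₂`. -/
def veeO2 (L1 : Set (Set X)) (L2 : Set (Set Y)) : Set (Set (X × Y)) :=
  {R | (∀ y : Y, {x | (x, y) ∈ R} ∈ L1) ∧ ∀ x : X, {y | (x, y) ∈ R} ∈ L2}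

/-- The binary separated product `L₁ ∧○ L₂`. -/
def wedgeO2 (L1 : Set (Set X)) (L2 : Set (Set Y)) : Set (Set (X × Y)) :=
  {S | ∃ ω : Set (Set (X × Y)),
    (∀ y ∈ ω, ∃ a₁ ∈ L1, ∃ a₂ ∈ L2,
      y = a₁ ×ˢ (Set.univ : Set Y) ∪ (Set.univ : Set X) ×ˢ a₂) ∧
    S = ⋂₀ ω}

end Binary

section Closure

variable {X : Type*} {L : Set (Set X)}

theorem cl_mem (hL : IsSCS L) (A : Set X) : cl L A ∈ L :=
  hL.1 _ fun _ hb => hb.1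

theorem subset_cl (L : Set (Set X)) (A : Set X) : A ⊆ cl L A :=
  subset_sInter fun _ hb => hb.2

theorem cl_subset {A b : Set X} (hb : b ∈ L) (h : A ⊆ b) : cl L A ⊆ b :=
  sInter_subset_of_mem ⟨hb, h⟩

theorem cl_eq_self {a : Set X} (ha : a ∈ L) : cl L a = a :=
  (cl_subset ha Subset.rfl).antisymm (subset_cl L a)

theorem IsSCS.inter_mem (hL : IsSCS L) {a b : Set X} (ha : a ∈ L) (hb : b ∈ L) :
    a ∩ b ∈ L := by
  rw [← sInter_pair]
  exact hL.1 _ (pair_subset ha hb)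

/-- Two points of a connected simple closure space cannot be separated by closed sets
whose union is closed. -/
theorem ConnectedSCS.mem_or_mem (h : ConnectedSCS L) {A B : Set X} (hA : A ∈ L) (hB : B ∈ L)
    (hAB : A ∪ B ∈ L) {x y : X} (hx : x ∈ A) (hy : y ∈ B) : x ∈ B ∨ y ∈ A := by
  by_cases hxy : x = y
  · exact Or.inr (hxy ▸ hx)
  obtain ⟨z, -, -, hz, hzx, hzy⟩ := h.2 x y hxy
  rcases cl_subset hAB (pair_subset (Or.inl hx) (Or.inr hy)) hz with hz | hz
  · exact Or.inr (cl_subset hA (pair_subset hx hz) hzy)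
  · exact Or.inl (cl_subset hB (pair_subset hy hz) hzx)

theorem ConnectedSCS.eq_univ_or_eq_univ (hL : IsSCS L) (h : ConnectedSCS L) {A B : Set X}
    (hA : A ∈ L) (hB : B ∈ L) (hAB : A ∪ B = univ) : A = univ ∨ B = univ := by
  by_contra! hne
  obtain ⟨y, hy⟩ := (ne_univ_iff_exists_notMem A).1 hne.1
  obtain ⟨x, hx⟩ := (ne_univ_iff_exists_notMem B).1 hne.2
  have hxA : x ∈ A := ((hAB ▸ mem_univ x : x ∈ A ∪ B)).resolve_right hx
  have hyB : y ∈ B := ((hAB ▸ mem_univ y : y ∈ A ∪ B)).resolve_left hy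
  exact (h.mem_or_mem hA hB (hAB ▸ hL.2.2.1) hxA hyB).elim hx hy

/-- The join-preserving map induced by a continuous point map. -/
theorem cl_image_cl_sUnion {Y : Type*} {K : Set (Set Y)} (hK : IsSCS K) {h : X → Y}
    (hh : ∀ b ∈ K, h ⁻¹' b ∈ L) (ω : Set (Set X)) :
    cl K (h '' cl L (⋃₀ ω)) = cl K (⋃₀ ((fun a => cl K (h '' a)) '' ω)) := by
  apply Subset.antisymm
  · refine cl_subset (cl_mem hK _) (image_subset_iff.2 (cl_subset (hh _ (cl_mem hK _)) ?_))
    rintro x ⟨a, ha, hx⟩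
    exact subset_cl K _ ⟨_, ⟨a, ha, rfl⟩, subset_cl K _ ⟨x, hx, rfl⟩⟩
  · refine cl_subset (cl_mem hK _) (sUnion_subset ?_)
    rintro _ ⟨a, ha, rfl⟩
    refine cl_subset (cl_mem hK _) ((image_mono ?_).trans (subset_cl K _))
    exact (subset_sUnion_of_mem ha).trans (subset_cl L _)

/-- A join-preserving map sending atoms to atoms is determined by its point map. -/
theorem eq_cl_image {u : Set X → Set X} {g : X → X}
    (hu : ∀ ω ⊆ L, u (cl L (⋃₀ ω)) = cl L (⋃₀ (u '' ω))) (hL : IsSCS L)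
    (hg : ∀ p, u {p} = {g p}) (A : Set X) : u (cl L A) = cl L (g '' A) := by
  have h := hu ((fun p => {p}) '' A) (image_subset_iff.2 fun p _ => hL.2.2.2 p)
  have h1 : ⋃₀ ((fun p => ({p} : Set X)) '' A) = A := by simp
  have h2 : ⋃₀ (u '' ((fun p => ({p} : Set X)) '' A)) = g '' A := by
    rw [image_image]
    ext y
    simp [hg, eq_comm]
  rwa [h1, h2] at h

theorem preimage_mem {u : Set X → Set X} {g : X → X}
    (hu : ∀ ω ⊆ L, u (cl L (⋃₀ ω)) = cl L (⋃₀ (u '' ω))) (hL : IsSCS L)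
    (hg : ∀ p, u {p} = {g p}) {b : Set X} (hb : b ∈ L) : g ⁻¹' b ∈ L := by
  suffices h : cl L (g ⁻¹' b) ⊆ g ⁻¹' b from
    (h.antisymm (subset_cl L _)) ▸ cl_mem hL _
  intro p hp
  have h1 := eq_cl_image hu hL hg (g ⁻¹' b)
  have h2 := eq_cl_image hu hL hg (cl L (g ⁻¹' b))
  rw [cl_eq_self (cl_mem hL _), h1] at h2
  have h3 : g p ∈ cl L (g '' (g ⁻¹' b)) := h2 ▸ subset_cl L _ ⟨p, hp, rfl⟩
  exact cl_subset hb (image_preimage_subset g b) h3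

end Closure

section Product

variable {ι : Type*} {σ : ι → Type*} {L : ∀ i, Set (Set (σ i))} {M : Set (Set (∀ i, σ i))}

theorem IsWTP.cylinder_mem (hM : IsWTP L M) (hL : ∀ i, IsSCS (L i)) {γ : ι} {b : Set (σ γ)}
    (hb : b ∈ L γ) : {q : ∀ i, σ i | q γ ∈ b} ∈ M := by
  classical
  convert hM.2.1 (Function.update (fun _ => ∅) γ b) ?_ using 1
  · ext q
    refine ⟨fun h => ⟨γ, by simpa using h⟩, ?_⟩
    rintro ⟨α, hα⟩
    by_cases h : α = γ
    · subst h; simpa using hα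
    · simp [h] at hα
  · intro α
    by_cases h : α = γ
    · subst h; simpa using hb
    · simpa [h] using (hL α).2.1

theorem IsWTP.coord_or_coord_mem (hM : IsWTP L M) (hL : ∀ i, IsSCS (L i)) (P Q : ∀ i, σ i)
    {α γ : ι} (hαγ : α ≠ γ) : {R : ∀ i, σ i | R α = P α ∨ R γ = Q γ} ∈ M := by
  classical
  convert hM.2.1 (fun δ => if δ = α then {P δ} else if δ = γ then {Q δ} else ∅) ?_ using 1
  · ext R
    constructor
    · rintro (h | h)
      · exact ⟨α, by simpa using h⟩
      · exact ⟨γ, by simpa [hαγ.symm] using h⟩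
    · rintro ⟨δ, hδ⟩
      dsimp only at hδ
      split_ifs at hδ with h₁ h₂
      · subst h₁; exact Or.inl hδ
      · subst h₂; exact Or.inr hδ
      · exact hδ.elim
  · intro δ
    split_ifs
    exacts [(hL δ).2.2.2 _, (hL δ).2.2.2 _, (hL δ).2.1]

theorem IsWTP.pair_mem (hM : IsWTP L M) (hL : ∀ i, IsSCS (L i)) {P Q : ∀ i, σ i}
    {α γ : ι} (hαγ : α ≠ γ) (hα : P α ≠ Q α) (hγ : P γ ≠ Q γ) : {P, Q} ∈ M := by
  suffices h : cl M {P, Q} ⊆ {P, Q} from h.antisymm (subset_cl M _) ▸ cl_mem hM.1 _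
  intro R hR
  have key : ∀ δ ε, δ ≠ ε → R δ = P δ ∨ R ε = Q ε := fun δ ε hδ =>
    cl_subset (hM.coord_or_coord_mem hL P Q hδ)
      (pair_subset (Or.inl rfl) (Or.inr rfl)) hR
  by_cases h : R α = P α
  · left
    have hne : ∀ δ, δ ≠ α → R δ = P δ := fun δ hδ =>
      (key δ α hδ).resolve_right (by rw [h]; exact hα)
    funext δ
    by_cases hδ : δ = α
    · rw [hδ, h]
    · exact hne δ hδ
  · right
    have hne : ∀ δ, δ ≠ α → R δ = Q δ := fun δ hδ => (key α δ hδ.symm).resolve_left h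
    funext δ
    by_cases hδ : δ = α
    · subst hδ
      exact (key γ δ hαγ.symm).resolve_left (by rw [hne γ hαγ.symm]; exact hγ.symm)
    · exact hne δ hδ

theorem IsWTP.line_mem (hM : IsWTP L M) (hL : ∀ i, IsSCS (L i)) (p : ∀ i, σ i) (β : ι) :
    cylSet p β univ ∈ M := by
  have h : cylSet p β univ = ⋂₀ {b | ∃ α, α ≠ β ∧ b = {q : ∀ i, σ i | q α ∈ ({p α} : Set _)}} := by
    ext q
    simp only [cylSet, mem_univ, true_and, mem_ofPred_eq, mem_sInter, mem_singleton_iff]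
    constructor
    · rintro h _ ⟨α, hα, rfl⟩
      exact h α hα
    · exact fun h α hα => h _ ⟨α, hα, rfl⟩
  rw [h]
  refine hM.1.1 _ ?_
  rintro _ ⟨α, -, rfl⟩
  exact hM.cylinder_mem hL ((hL α).2.2.2 _)

variable [DecidableEq ι]

theorem mem_cylSet_iff {p q : ∀ i, σ i} {β : ι} {A : Set (σ β)} :
    q ∈ cylSet p β A ↔ ∃ x ∈ A, q = Function.update p β x := by
  constructor
  · rintro ⟨h, h'⟩
    exact ⟨q β, h, (Function.update_eq_iff.2 ⟨rfl, fun α hα => (h' α hα).symm⟩).symm⟩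
  · rintro ⟨x, hx, rfl⟩
    exact ⟨by simpa using hx, fun α hα => by simp [hα]⟩

/-- Lines are embedded continuously in a weak tensor product. -/
theorem IsWTP.section_mem (hM : IsWTP L M) (hL : ∀ i, IsSCS (L i)) (p : ∀ i, σ i) (β : ι)
    {S : Set (∀ i, σ i)} (hS : S ∈ M) : {x | Function.update p β x ∈ S} ∈ L β := by
  refine hM.2.2 p β _ ?_
  convert hM.1.inter_mem hS (hM.line_mem hL p β) using 1
  ext q
  rw [mem_inter_iff, mem_cylSet_iff, mem_cylSet_iff]
  constructor
  · rintro ⟨x, hx, rfl⟩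
    exact ⟨hx, x, mem_univ x, rfl⟩
  · rintro ⟨hq, x, -, rfl⟩
    exact ⟨x, hq, rfl⟩

theorem apply_eq_of_update [Finite ι] {T : Type*} (F : (∀ i, σ i) → T) (p q : ∀ i, σ i)
    (h : ∀ α, p α = q α ∨ ∀ r t, F (Function.update r α t) = F r) : F p = F q := by
  have := Fintype.ofFinite ι
  suffices hs : ∀ s : Finset ι, F (s.piecewise q p) = F p by
    simpa using (hs Finset.univ).symm
  intro s
  induction s using Finset.induction_on with
  | empty => simp
  | insert α s hα ih =>
    rw [Finset.piecewise_insert]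
    rcases h α with h | h
    · rwa [← h, Function.update_eq_self_iff.2]
      rw [Finset.piecewise_eq_of_notMem _ _ _ hα]
    · rw [h, ih]

/-- `g` maps the line through `p` in direction `β` to a nondegenerate part of a line in
direction `γ`. -/
def LineDirection (g : (∀ i, σ i) → ∀ i, σ i) (p : ∀ i, σ i) (β γ : ι) : Prop :=
  (∃ x y, g (Function.update p β x) γ ≠ g (Function.update p β y) γ) ∧
  ∀ δ, δ ≠ γ → ∀ x y, g (Function.update p β x) δ = g (Function.update p β y) δ

theorem LineDirection.unique {g : (∀ i, σ i) → ∀ i, σ i} {p : ∀ i, σ i} {β γ γ' : ι}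
    (h : LineDirection g p β γ) (h' : LineDirection g p β γ') : γ = γ' := by
  by_contra hne
  obtain ⟨x, y, hxy⟩ := h.1
  exact hxy (h'.2 γ hne x y)

section Continuous

variable {g : (∀ i, σ i) → ∀ i, σ i}

/-- A continuous point map does not increase the Hamming distance of collinear points. -/
theorem IsWTP.coord_eq_or_coord_eq (hM : IsWTP L M) (hL : ∀ i, IsSCS (L i))
    (hconn : ∀ i, ConnectedSCS (L i)) (hg : ∀ b ∈ M, g ⁻¹' b ∈ M) (p : ∀ i, σ i) (β : ι)
    (x y : σ β) {α γ : ι} (hαγ : α ≠ γ) :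
    g (Function.update p β x) α = g (Function.update p β y) α ∨
      g (Function.update p β x) γ = g (Function.update p β y) γ := by
  by_contra! h
  have hsec := fun S (hS : S ∈ M) => hM.section_mem hL p β (hg S hS)
  rcases (hconn β).mem_or_mem (hsec _ (hM.1.2.2.2 (g (Function.update p β x))))
    (hsec _ (hM.1.2.2.2 (g (Function.update p β y)))) (hsec _ (hM.pair_mem hL hαγ h.1 h.2))
    (x := x) (y := y) rfl rfl with h' | h'
  · exact h.1 (congrFun h' α)
  · exact h.1 (congrFun h' α).symm

theorem IsWTP.exists_lineDirection (hM : IsWTP L M) (hL : ∀ i, IsSCS (L i))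
    (hconn : ∀ i, ConnectedSCS (L i)) (hg : ∀ b ∈ M, g ⁻¹' b ∈ M) (p : ∀ i, σ i) (β : ι)
    (hne : ∃ x y, g (Function.update p β x) ≠ g (Function.update p β y)) :
    ∃ γ, LineDirection g p β γ := by
  obtain ⟨x₀, y₀, hne⟩ := hne
  obtain ⟨γ, hγ⟩ := Function.ne_iff.1 hne
  refine ⟨γ, ⟨x₀, y₀, hγ⟩, fun δ hδ => ?_⟩
  have hor := fun x y => hM.coord_eq_or_coord_eq hL hconn hg p β x y hδ
  have h₀ := (hor x₀ y₀).resolve_right hγ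
  suffices h : ∀ x, g (Function.update p β x) δ = g (Function.update p β x₀) δ from
    fun x y => (h x).trans (h y).symm
  intro x
  rcases hor x x₀ with h | h
  · exact h
  · exact ((hor x y₀).resolve_right (by rw [h]; exact hγ)).trans h₀.symm

theorem IsWTP.lineDirection_update (hM : IsWTP L M) (hL : ∀ i, IsSCS (L i))
    (hconn : ∀ i, ConnectedSCS (L i)) (hg : ∀ b ∈ M, g ⁻¹' b ∈ M) {p : ∀ i, σ i} {α β γ γ' : ι}
    {t : σ α} (h : LineDirection g p β γ)
    (h' : LineDirection g (Function.update p α t) β γ') : γ' = γ := by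
  by_cases hαβ : α = β
  · subst hαβ
    unfold LineDirection at h'
    simp only [Function.update_idem] at h'
    exact LineDirection.unique h' h
  by_contra hne
  obtain ⟨⟨x₀, x₁, hx⟩, hP⟩ := h
  obtain ⟨⟨y₀, y₁, hy⟩, hQ⟩ := h'
  set p' := Function.update p α t with hp'
  have hsec : ∀ r δ (c : σ δ), {x | g (Function.update r β x) δ ∈ ({c} : Set (σ δ))} ∈ L β :=
    fun r δ c => hM.section_mem hL r β
      (hg _ (hM.cylinder_mem hL ((hL δ).2.2.2 c)))
  have hcover := (hconn β).eq_univ_or_eq_univ (hL β)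
    (hsec p γ (g (Function.update p' β y₀) γ)) (hsec p' γ' (g (Function.update p β x₀) γ')) ?_
  · rcases hcover with h | h
    · exact hx (((eq_univ_iff_forall.1 h x₀).trans (eq_univ_iff_forall.1 h x₁).symm :))
    · exact hy (((eq_univ_iff_forall.1 h y₀).trans (eq_univ_iff_forall.1 h y₁).symm :))
  · refine eq_univ_of_forall fun x => ?_
    have hor := hM.coord_eq_or_coord_eq hL hconn hg (Function.update p β x) α (p α) t
      (Ne.symm hne)
    have e₁ : Function.update (Function.update p β x) α (p α) = Function.update p β x := by
      rw [Function.update_eq_self_iff, Function.update_of_ne hαβ]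
    have e₂ : Function.update (Function.update p β x) α t = Function.update p' β x := by
      rw [hp', Function.update_comm hαβ]
    rw [e₁, e₂] at hor
    rcases hor with h | h
    · exact Or.inl (h.trans (hQ γ (Ne.symm hne) x y₀))
    · exact Or.inr (h.symm.trans (hP γ' hne x x₀))

theorem IsWTP.exists_direction [Finite ι] [∀ i, Nonempty (σ i)] (hM : IsWTP L M)
    (hL : ∀ i, IsSCS (L i)) (hconn : ∀ i, ConnectedSCS (L i)) (hg : ∀ b ∈ M, g ⁻¹' b ∈ M)
    (hne : ∀ p β, ∃ x y, g (Function.update p β x) ≠ g (Function.update p β y)) :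
    ∃ d : ι → ι, ∀ p β, LineDirection g p β (d β) := by
  choose d hd using fun p β => hM.exists_lineDirection hL hconn hg p β (hne p β)
  refine ⟨d (fun i => Classical.arbitrary (σ i)), fun p β => ?_⟩
  rw [apply_eq_of_update (fun q => d q β) _ p fun α => Or.inr fun r t =>
    hM.lineDirection_update hL hconn hg (hd r β) (hd (Function.update r α t) β)]
  exact hd p β

theorem direction_surjective [Finite ι] [∀ i, Nonempty (σ i)] {d : ι → ι}
    (hd : ∀ p β, LineDirection g p β (d β))
    (hne : ∀ γ, ∃ p q, g p γ ≠ g q γ) : Function.Surjective d := by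
  intro γ
  by_contra! h
  obtain ⟨p, q, hpq⟩ := hne γ
  refine hpq (apply_eq_of_update (fun r => g r γ) p q fun α => Or.inr fun r t => ?_)
  simpa using (hd r α).2 γ (h α).symm t (r α)

end Continuous

end Product

/-- factorization of large join-preserving atom-maps of a weak tensor
product of connected simple closure spaces. -/
theorem stmt14 {n : ℕ} {σ : Fin n → Type*} [∀ i, Nonempty (σ i)]
    (L : ∀ i, Set (Set (σ i))) (hL : ∀ i, IsSCS (L i))
    (hconn : ∀ i, ConnectedSCS (L i))
    (M : Set (Set (∀ i, σ i))) (hM : IsWTP L M)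
    (u : Set (∀ i, σ i) → Set (∀ i, σ i))
    (humem : ∀ a ∈ M, u a ∈ M)
    (hujoin : ∀ ω ⊆ M, u (cl M (⋃₀ ω)) = cl M (⋃₀ (u '' ω)))
    (huatom : ∀ p : ∀ i, σ i, ∃ q : ∀ i, σ i, u {p} = {q})
    (hlarge : LargeMap u) :
    ∃ f : Fin n ≃ Fin n, ∃ v : ∀ i : Fin n, Set (σ i) → Set (σ (f i)),
      ∀ i : Fin n,
        (∀ a ∈ L i, v i a ∈ L (f i)) ∧
        (∀ ω ⊆ L i, v i (cl (L i) (⋃₀ ω)) = cl (L (f i)) (⋃₀ (v i '' ω))) ∧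
        (∀ x : σ i, ∃ y : σ (f i), v i {x} = {y}) ∧
        ∀ (p q : ∀ j, σ j), u {p} = {q} → v i {p i} = {q (f i)} := by
  choose g hg using huatom
  have hgM : ∀ b ∈ M, g ⁻¹' b ∈ M := fun b hb => preimage_mem hujoin hM.1 hg hb
  have hu : ∀ a ∈ M, u a = cl M (g '' a) := fun a ha => by
    rw [← eq_cl_image hujoin hM.1 hg, cl_eq_self ha]
  have hline : ∀ p β, ∃ x y, g (Function.update p β x) ≠ g (Function.update p β y) := by
    intro p β
    by_contra! h
    refine (hlarge β p).1 ⟨g p, ?_⟩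
    have himage : g '' cylSet p β univ = {g p} := by
      refine Subset.antisymm ?_ (singleton_subset_iff.2 ⟨p, ⟨mem_univ _, fun _ _ => rfl⟩, rfl⟩)
      rintro _ ⟨q, hq, rfl⟩
      obtain ⟨x, -, rfl⟩ := mem_cylSet_iff.1 hq
      simpa using h x (p β)
    rw [hu _ (hM.line_mem hL p β), himage, cl_eq_self (hM.1.2.2.2 _)]
  have hcoord : ∀ γ, ∃ p q, g p γ ≠ g q γ := by
    intro γ
    by_contra! h
    let p₀ : ∀ i, σ i := fun i => Classical.arbitrary (σ i)
    refine (hlarge γ (g p₀)).2 ?_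
    rw [hu _ hM.1.2.2.1]
    refine cl_subset (hM.cylinder_mem hL ((hL γ).2.2.2 (g p₀ γ))) ?_
    rintro _ ⟨p, -, rfl⟩
    exact h p p₀
  obtain ⟨d, hd⟩ := hM.exists_direction hL hconn hgM hline
  have hbij : Function.Bijective d :=
    Finite.surjective_iff_bijective.1 (direction_surjective hd hcoord)
  have hdep : ∀ i p q, p i = q i → g p (d i) = g q (d i) := by
    intro i p q hpq
    refine apply_eq_of_update (fun r => g r (d i)) p q fun α => ?_
    by_cases hα : α = i
    · exact Or.inl (hα ▸ hpq)
    · refine Or.inr fun r t => ?_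
      simpa using (hd r α).2 (d i) (fun h => hα (hbij.1 h).symm) t (r α)
  let p₀ : ∀ i, σ i := fun i => Classical.arbitrary (σ i)
  let h : ∀ i, σ i → σ (d i) := fun i x => g (Function.update p₀ i x) (d i)
  have hh : ∀ i, ∀ b ∈ L (d i), h i ⁻¹' b ∈ L i := fun i b hb =>
    hM.section_mem hL p₀ i (hgM _ (hM.cylinder_mem hL hb))
  have hatom : ∀ i x, cl (L (d i)) (h i '' {x}) = {h i x} := fun i x => by
    rw [image_singleton, cl_eq_self ((hL _).2.2.2 _)]
  refine ⟨Equiv.ofBijective d hbij, fun i a => cl (L (d i)) (h i '' a), fun i =>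
    ⟨fun a _ => cl_mem (hL _) _, fun ω _ => cl_image_cl_sUnion (hL _) (hh i) ω,
      fun x => ⟨h i x, hatom i x⟩, fun p q hpq => ?_⟩⟩
  have hq : g p = q := singleton_injective ((hg p).symm.trans hpq)
  refine (hatom i (p i)).trans (congrArg _ ?_)
  rw [← hq]
  exact hdep i _ _ (by simp)

end QLTensor
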